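/- arXiv:1411.1915 — 2 statements merged into one kernel-verified Lean document; each statement's English description precedes it below -/
import Mathlib

section
/- Let k ≥ 1 be an integer, R > 0, and let x ∈ ℝ^{k+1} be a fixed point with 0 < r := |x| and r ≠ R. Suppose α, β ∈ ℂ satisfy max{|Im(α)|, |Im(β)|} ≤ (π/2) / ln((R + r)/|R − r|). If ∫_{S^k(R)} ω(x,y)^α dS_y = ∫_{S^k(R)} ω(x,y)^β dS_y, then α + β = k or α = β. -/
open MeasureTheory

/-- The spherical ratio `ω(x,y) = |‖x‖² − R²| / ‖x − y‖²`. -/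
noncomputable def sRatio {n : ℕ} (R : ℝ) (x y : EuclideanSpace ℝ (Fin n)) : ℝ :=
  |‖x‖ ^ 2 - R ^ 2| / ‖x - y‖ ^ 2

open Set in
theorem exists_mem_Ioo_eq_of_integral_eq {σ : Measure ℝ} [IsFiniteMeasure σ] {L : ℝ}
    (hsupp : ∀ᵐ t ∂σ, |t| ≤ L) (hpos : σ {t | 0 < |t| ∧ |t| < L} ≠ 0)
    {w f g : ℝ → ℝ} (hw : Continuous w) (hf : Continuous f) (hg : Continuous g)
    (hw0 : ∀ t, 0 < w t) (hfe : ∀ t, f |t| = f t) (hge : ∀ t, g |t| = g t)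
    (hfg : ∀ t, 0 ≤ t → t ≤ L → f t ≤ g t)
    (h : ∫ t, w t * f t ∂σ = ∫ t, w t * g t ∂σ) :
    ∃ t, 0 < t ∧ t < L ∧ f t = g t := by
  have hint : ∀ {F : ℝ → ℝ}, Continuous F → Integrable F σ := by
    intro F hF
    have hs : σ.restrict (Icc (-L) L) = σ :=
      Measure.restrict_eq_self_of_ae_mem (hsupp.mono fun t ht => abs_le.1 ht)
    rw [← hs]
    exact hF.continuousOn.integrableOn_Icc
  have hle : (fun t => w t * f t) ≤ᵐ[σ] fun t => w t * g t := by
    filter_upwards [hsupp] with t ht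
    have := hfg |t| (abs_nonneg t) ht
    rw [hfe, hge] at this
    exact mul_le_mul_of_nonneg_left this (hw0 t).le
  have heq := (integral_eq_iff_of_ae_le (hint (hw.mul hf)) (hint (hw.mul hg)) hle).1 h
  have hfreq : ∃ᵐ t ∂σ, 0 < |t| ∧ |t| < L := frequently_ae_iff.2 hpos
  obtain ⟨t, ⟨h0, h1⟩, h2⟩ := (hfreq.and_eventually heq).exists
  refine ⟨|t|, h0, h1, ?_⟩
  rw [hfe, hge]
  exact mul_left_cancel₀ (hw0 t).ne' h2

theorem eq_and_eq_of_integral_cosh_cos_eq {σ : Measure ℝ} [IsFiniteMeasure σ] {L : ℝ}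
    (hsupp : ∀ᵐ t ∂σ, |t| ≤ L) (hpos : σ {t | 0 < |t| ∧ |t| < L} ≠ 0)
    {w : ℝ → ℝ} (hw : Continuous w) (hw0 : ∀ t, 0 < w t)
    {a₁ a₂ b₁ b₂ : ℝ} (ha₁ : 0 ≤ a₁) (ha₂ : 0 ≤ a₂) (hb₁ : 0 ≤ b₁) (hb₂ : 0 ≤ b₂)
    (haL : a₂ * L ≤ Real.pi / 2) (hbL : b₂ * L ≤ Real.pi / 2)
    (hC : ∫ t, w t * (Real.cosh (a₁ * t) * Real.cos (a₂ * t)) ∂σ =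
      ∫ t, w t * (Real.cosh (b₁ * t) * Real.cos (b₂ * t)) ∂σ)
    (hS : ∫ t, w t * (Real.sinh (a₁ * t) * Real.sin (a₂ * t)) ∂σ =
      ∫ t, w t * (Real.sinh (b₁ * t) * Real.sin (b₂ * t)) ∂σ) :
    a₁ = b₁ ∧ a₂ = b₂ := by
  wlog hab : b₁ ≤ a₁ generalizing a₁ a₂ b₁ b₂
  · have := this hb₁ hb₂ ha₁ ha₂ hbL haL hC.symm hS.symm (le_of_not_ge hab)
    exact ⟨this.1.symm, this.2.symm⟩
  have hcE : ∀ p q t : ℝ, Real.cosh (p * |t|) * Real.cos (q * |t|) =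
      Real.cosh (p * t) * Real.cos (q * t) := by
    intro p q t
    rcases abs_choice t with h | h <;> simp [h]
  have hsE : ∀ p q t : ℝ, Real.sinh (p * |t|) * Real.sin (q * |t|) =
      Real.sinh (p * t) * Real.sin (q * t) := by
    intro p q t
    rcases abs_choice t with h | h <;> simp [h]
  have hpi := Real.pi_pos
  have hbd : ∀ {q t : ℝ}, 0 ≤ q → q * L ≤ Real.pi / 2 → t ≤ L → q * t ≤ Real.pi / 2 :=
    fun hq hqL ht => (mul_le_mul_of_nonneg_left ht hq).trans hqL
  have hcos0 : ∀ {q t : ℝ}, 0 ≤ q → q * L ≤ Real.pi / 2 → 0 ≤ t → t ≤ L → 0 ≤ Real.cos (q * t) :=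
    fun hq hqL h0 ht => Real.cos_nonneg_of_neg_pi_div_two_le_of_le
      (by have := mul_nonneg hq h0; linarith) (hbd hq hqL ht)
  have hsin0 : ∀ {q t : ℝ}, 0 ≤ q → q * L ≤ Real.pi / 2 → 0 ≤ t → t ≤ L → 0 ≤ Real.sin (q * t) :=
    fun hq hqL h0 ht => Real.sin_nonneg_of_nonneg_of_le_pi (mul_nonneg hq h0)
      (by have := hbd hq hqL ht; linarith)
  have hcosh : ∀ {t : ℝ}, 0 ≤ t → Real.cosh (b₁ * t) ≤ Real.cosh (a₁ * t) := by
    intro t ht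
    rw [Real.cosh_le_cosh, abs_of_nonneg (by positivity), abs_of_nonneg (by positivity)]
    gcongr
  have h21 : b₂ ≤ a₂ := by
    by_contra! hlt
    obtain ⟨t, h0, h1, he⟩ := exists_mem_Ioo_eq_of_integral_eq hsupp hpos
      (f := fun t => Real.cosh (b₁ * t) * Real.cos (b₂ * t))
      (g := fun t => Real.cosh (a₁ * t) * Real.cos (a₂ * t)) hw (by fun_prop) (by fun_prop) hw0
      (hcE _ _) (hcE _ _)
      (fun t h0 h1 => mul_le_mul (hcosh h0)
        (Real.cos_le_cos_of_nonneg_of_le_pi (by positivity)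
          (by have := hbd hb₂ hbL h1; linarith) (by gcongr))
        (hcos0 hb₂ hbL h0 h1) (Real.cosh_pos _).le) hC.symm
    have hc : Real.cos (b₂ * t) < Real.cos (a₂ * t) :=
      Real.cos_lt_cos_of_nonneg_of_le_pi (by positivity)
          (by have := hbd hb₂ hbL h1.le; linarith) (by gcongr)
    have hlt' := mul_lt_mul' (hcosh h0.le) hc (hcos0 hb₂ hbL h0.le h1.le)
      (Real.cosh_pos (a₁ * t))
    exact hlt'.ne he
  have hsin : ∀ {t : ℝ}, 0 ≤ t → t ≤ L → Real.sin (b₂ * t) ≤ Real.sin (a₂ * t) := by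
    intro t h0 h1
    exact Real.sin_le_sin_of_le_of_le_pi_div_two (by have := mul_nonneg hb₂ h0; linarith)
      (hbd ha₂ haL h1) (by gcongr)
  have h11 : a₁ = b₁ := by
    by_contra hne
    have hlt : b₁ < a₁ := lt_of_le_of_ne hab (Ne.symm hne)
    obtain ⟨t, h0, h1, he⟩ := exists_mem_Ioo_eq_of_integral_eq hsupp hpos
      (f := fun t => Real.sinh (b₁ * t) * Real.sin (b₂ * t))
      (g := fun t => Real.sinh (a₁ * t) * Real.sin (a₂ * t)) hw (by fun_prop) (by fun_prop) hw0
      (hsE _ _) (hsE _ _)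
      (fun t h0 h1 => mul_le_mul (Real.sinh_le_sinh.2 (by gcongr)) (hsin h0 h1)
        (hsin0 hb₂ hbL h0 h1) (Real.sinh_nonneg_iff.2 (by positivity))) hS.symm
    rcases ha₂.eq_or_lt with h0a | h0a
    · have h0b : b₂ = 0 := by linarith
      subst h0b
      subst h0a
      obtain ⟨s, hs0, hs1, hse⟩ := exists_mem_Ioo_eq_of_integral_eq hsupp hpos
        (f := fun t => Real.cosh (b₁ * t) * Real.cos (0 * t))
        (g := fun t => Real.cosh (a₁ * t) * Real.cos (0 * t)) hw (by fun_prop) (by fun_prop) hw0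
        (hcE _ _) (hcE _ _) (fun t h0 _ => by simpa using hcosh h0) hC.symm
      have : Real.cosh (b₁ * s) < Real.cosh (a₁ * s) := by
        rw [Real.cosh_lt_cosh, abs_of_nonneg (by positivity), abs_of_nonneg (by positivity)]
        gcongr
      simp at hse
      linarith
    · have hs : 0 < Real.sin (a₂ * t) := Real.sin_pos_of_pos_of_lt_pi (by positivity)
        (by have := hbd ha₂ haL h1.le; linarith)
      have h3 : Real.sinh (b₁ * t) < Real.sinh (a₁ * t) := Real.sinh_lt_sinh.2 (by gcongr)
      have h4 : Real.sinh (b₁ * t) * Real.sin (b₂ * t) ≤ Real.sinh (b₁ * t) * Real.sin (a₂ * t) :=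
        mul_le_mul_of_nonneg_left (hsin h0.le h1.le) (Real.sinh_nonneg_iff.2 (by positivity))
      have h5 := mul_lt_mul_of_pos_right h3 hs
      exact (h4.trans_lt h5).ne he
  refine ⟨h11, ?_⟩
  subst h11
  obtain ⟨t, h0, h1, he⟩ := exists_mem_Ioo_eq_of_integral_eq hsupp hpos
    (f := fun t => Real.cosh (a₁ * t) * Real.cos (a₂ * t))
    (g := fun t => Real.cosh (a₁ * t) * Real.cos (b₂ * t)) hw (by fun_prop) (by fun_prop) hw0
    (hcE _ _) (hcE _ _)
    (fun t h0 h1 => mul_le_mul_of_nonneg_left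
      (Real.cos_le_cos_of_nonneg_of_le_pi (by positivity)
        (by have := hbd ha₂ haL h1; linarith) (by gcongr)) (Real.cosh_pos _).le) hC
  have hc := mul_left_cancel₀ (Real.cosh_pos (a₁ * t)).ne' he
  have := Real.injOn_cos ⟨by positivity, by have := hbd ha₂ haL h1.le; linarith⟩
    ⟨by positivity, by have := hbd hb₂ hbL h1.le; linarith⟩ hc
  exact mul_right_cancel₀ h0.ne' this

theorem eq_or_eq_neg_of_integral_cosh_cos_eq {σ : Measure ℝ} [IsFiniteMeasure σ] {L : ℝ}
    (hsupp : ∀ᵐ t ∂σ, |t| ≤ L) (hpos : σ {t | 0 < |t| ∧ |t| < L} ≠ 0)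
    {w : ℝ → ℝ} (hw : Continuous w) (hw0 : ∀ t, 0 < w t)
    {a₁ a₂ b₁ b₂ : ℝ} (haL : |a₂| * L ≤ Real.pi / 2) (hbL : |b₂| * L ≤ Real.pi / 2)
    (hC : ∫ t, w t * (Real.cosh (a₁ * t) * Real.cos (a₂ * t)) ∂σ =
      ∫ t, w t * (Real.cosh (b₁ * t) * Real.cos (b₂ * t)) ∂σ)
    (hS : ∫ t, w t * (Real.sinh (a₁ * t) * Real.sin (a₂ * t)) ∂σ =
      ∫ t, w t * (Real.sinh (b₁ * t) * Real.sin (b₂ * t)) ∂σ) :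
    (a₁ = b₁ ∧ a₂ = b₂) ∨ (a₁ = -b₁ ∧ a₂ = -b₂) := by
  wlog ha₁ : 0 ≤ a₁ generalizing a₁ a₂
  · have := @this (-a₁) (-a₂) (by simpa using haL) (by simpa using hC) (by simpa using hS)
      (by linarith)
    grind
  wlog hb₁ : 0 ≤ b₁ generalizing b₁ b₂
  · have := @this (-b₁) (-b₂) (by simpa using hbL) (by simpa using hC) (by simpa using hS)
      (by linarith)
    grind
  wlog ha₂ : 0 ≤ a₂ generalizing a₂ b₂
  · have := @this (-a₂) (by simpa using haL) (-b₂) (by simpa using hbL) (by simpa using hC)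
      (by simpa [integral_neg] using hS) (by linarith)
    grind
  rw [abs_of_nonneg ha₂] at haL
  rcases le_total 0 b₂ with hb₂ | hb₂
  · rw [abs_of_nonneg hb₂] at hbL
    exact .inl (eq_and_eq_of_integral_cosh_cos_eq hsupp hpos hw hw0 ha₁ ha₂ hb₁ hb₂ haL hbL hC hS)
  · rw [abs_of_nonpos hb₂] at hbL
    have hsE : ∀ p q t : ℝ, Real.sinh (p * |t|) * Real.sin (q * |t|) =
        Real.sinh (p * t) * Real.sin (q * t) := by
      intro p q t
      rcases abs_choice t with h | h <;> simp [h]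
    have hpt : ∀ {p q t : ℝ}, 0 ≤ p → 0 ≤ q → q * L ≤ Real.pi / 2 → 0 ≤ t → t ≤ L →
        0 ≤ Real.sinh (p * t) * Real.sin (q * t) := by
      intro p q t hp hq hqL h0 h1
      have := mul_le_mul_of_nonneg_left h1 hq
      exact mul_nonneg (Real.sinh_nonneg_iff.2 (by positivity))
        (Real.sin_nonneg_of_nonneg_of_le_pi (by positivity) (by linarith [Real.pi_pos]))
    have hnn : ∀ {p q : ℝ}, 0 ≤ p → 0 ≤ q → q * L ≤ Real.pi / 2 →
        0 ≤ ∫ t, w t * (Real.sinh (p * t) * Real.sin (q * t)) ∂σ := by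
      intro p q hp hq hqL
      refine integral_nonneg_of_ae ?_
      filter_upwards [hsupp] with t ht
      rw [← hsE]
      exact mul_nonneg (hw0 t).le (hpt hp hq hqL (abs_nonneg t) ht)
    have hneg : ∫ t, w t * (Real.sinh (b₁ * t) * Real.sin (-b₂ * t)) ∂σ =
        -∫ t, w t * (Real.sinh (b₁ * t) * Real.sin (b₂ * t)) ∂σ := by
      simp [integral_neg]
    have h1 := hnn ha₁ ha₂ haL
    have h2 := hnn hb₁ (neg_nonneg.2 hb₂) hbL
    obtain ⟨h11, h22⟩ := eq_and_eq_of_integral_cosh_cos_eq hsupp hpos hw hw0 ha₁ ha₂ hb₁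
      (neg_nonneg.2 hb₂) haL hbL (by simpa using hC) (by linarith)
    obtain ⟨t, ht0, ht1, he⟩ := exists_mem_Ioo_eq_of_integral_eq hsupp hpos
      (f := fun _ => 0) (g := fun t => Real.sinh (a₁ * t) * Real.sin (a₂ * t)) hw
      (by fun_prop) (by fun_prop) hw0 (fun _ => rfl) (hsE _ _)
      (fun t h0 h1 => hpt ha₁ ha₂ haL h0 h1) (by simp only [mul_zero, integral_zero]; linarith)
    rcases mul_eq_zero.1 he.symm with h | h
    · rw [Real.sinh_eq_zero] at h
      have : a₁ = 0 := (mul_eq_zero.1 h).resolve_right ht0.ne'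
      right
      constructor <;> linarith
    · have hpi := Real.pi_pos
      have := mul_le_mul_of_nonneg_left ht1.le ha₂
      have h0 := (Real.sin_eq_zero_iff_of_lt_of_lt
        (by have := mul_nonneg ha₂ ht0.le; linarith) (by linarith)).1 h
      have : a₂ = 0 := (mul_eq_zero.1 h0).resolve_right ht0.ne'
      left
      constructor <;> linarith

/-- A finite measure on a bounded interval that `t ↦ -t` maps to its multiple by `exp (k t)`
determines the exponent `α` from `∫ exp (α t)` up to `α ↦ k - α`, for `α` of small imaginary
part. -/
theorem add_eq_or_eq_of_integral_cexp_eq {σ : Measure ℝ} [IsFiniteMeasure σ] {L k : ℝ}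
    (hsupp : ∀ᵐ t ∂σ, |t| ≤ L) (hpos : σ {t | 0 < |t| ∧ |t| < L} ≠ 0)
    (hsymm : σ.map (fun t => -t) = σ.withDensity fun t => ENNReal.ofReal (Real.exp (k * t)))
    {α β : ℂ} (hα : |α.im| * L ≤ Real.pi / 2) (hβ : |β.im| * L ≤ Real.pi / 2)
    (h : ∫ t : ℝ, Complex.exp (α * t) ∂σ = ∫ t : ℝ, Complex.exp (β * t) ∂σ) :
    α + β = k ∨ α = β := by
  have hint : ∀ {F : ℝ → ℂ}, Continuous F → Integrable F σ := by
    intro F hF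
    have hs : σ.restrict (Set.Icc (-L) L) = σ :=
      Measure.restrict_eq_self_of_ae_mem (hsupp.mono fun t ht => abs_le.1 ht)
    rw [← hs]
    exact hF.continuousOn.integrableOn_Icc
  have hrefl : ∀ γ : ℂ, ∫ t : ℝ, Complex.exp (γ * t) ∂σ =
      ∫ t : ℝ, Complex.exp ((k - γ) * t) ∂σ := by
    intro γ
    have h1 : ∫ t : ℝ, Complex.exp (γ * t) ∂σ =
        ∫ t : ℝ, Complex.exp (-(γ * t)) ∂(σ.map (fun t => -t)) := by
      rw [integral_map (by fun_prop)
        (Continuous.aestronglyMeasurable (by fun_prop))]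
      simp
    rw [h1, hsymm, integral_withDensity_eq_integral_toReal_smul (by fun_prop) (by simp)]
    congr 1 with t
    rw [ENNReal.toReal_ofReal (Real.exp_pos _).le, Complex.real_smul, Complex.ofReal_exp,
      ← Complex.exp_add]
    congr 1
    push_cast
    ring
  have hcosh : ∀ γ : ℂ, ∫ t : ℝ, Complex.exp (γ * t) ∂σ =
      ∫ t : ℝ, (Real.exp (k / 2 * t) : ℂ) * Complex.cosh ((γ - k / 2) * t) ∂σ := by
    intro γ
    have h2 : (2 : ℂ) * ∫ t : ℝ, Complex.exp (γ * t) ∂σ =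
        2 * ∫ t : ℝ, (Real.exp (k / 2 * t) : ℂ) * Complex.cosh ((γ - k / 2) * t) ∂σ := by
      rw [two_mul]
      nth_rewrite 2 [hrefl]
      rw [← integral_add (hint (by fun_prop)) (hint (by fun_prop)), ← integral_const_mul]
      congr 1 with t
      rw [Complex.cosh, Complex.ofReal_exp]
      field_simp
      rw [mul_add, ← Complex.exp_add, ← Complex.exp_add]
      congr 2 <;> push_cast <;> ring
    exact mul_left_cancel₀ two_ne_zero h2
  rw [hcosh, hcosh] at h
  have hpart : ∀ (γ : ℂ) (t : ℝ), (Real.exp (k / 2 * t) : ℂ) * Complex.cosh ((γ - k / 2) * t) =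
      ((Real.exp (k / 2 * t) *
        (Real.cosh ((γ.re - k / 2) * t) * Real.cos (γ.im * t)) : ℝ) : ℂ) +
      ((Real.exp (k / 2 * t) *
        (Real.sinh ((γ.re - k / 2) * t) * Real.sin (γ.im * t)) : ℝ) : ℂ) * Complex.I := by
    intro γ t
    have : (γ - k / 2) * t = (((γ.re - k / 2) * t : ℝ) : ℂ) + ((γ.im * t : ℝ) : ℂ) * Complex.I := by
      nth_rewrite 1 [← Complex.re_add_im γ]
      push_cast
      ring
    rw [this, Complex.cosh_add, Complex.cosh_mul_I, Complex.sinh_mul_I]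
    push_cast
    ring
  have hre : ∀ γ : ℂ,
      (∫ t : ℝ, (Real.exp (k / 2 * t) : ℂ) * Complex.cosh ((γ - k / 2) * t) ∂σ).re =
      ∫ t, Real.exp (k / 2 * t) *
        (Real.cosh ((γ.re - k / 2) * t) * Real.cos (γ.im * t)) ∂σ := by
    intro γ
    rw [← RCLike.re_eq_complex_re, ← integral_re (hint (by fun_prop))]
    congr 1 with t
    rw [hpart, RCLike.re_eq_complex_re, Complex.add_re, Complex.ofReal_re, Complex.re_ofReal_mul]
    simp
  have him : ∀ γ : ℂ,
      (∫ t : ℝ, (Real.exp (k / 2 * t) : ℂ) * Complex.cosh ((γ - k / 2) * t) ∂σ).im =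
      ∫ t, Real.exp (k / 2 * t) *
        (Real.sinh ((γ.re - k / 2) * t) * Real.sin (γ.im * t)) ∂σ := by
    intro γ
    rw [← RCLike.im_eq_complex_im, ← integral_im (hint (by fun_prop))]
    congr 1 with t
    rw [hpart, RCLike.im_eq_complex_im, Complex.add_im, Complex.ofReal_im, Complex.im_ofReal_mul]
    simp
  have hC := congrArg Complex.re h
  have hS := congrArg Complex.im h
  rw [hre, hre] at hC
  rw [him, him] at hS
  rcases eq_or_eq_neg_of_integral_cosh_cos_eq hsupp hpos (by fun_prop)
    (fun t => Real.exp_pos _) hα hβ hC hS with ⟨h1, h2⟩ | ⟨h1, h2⟩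
  · right
    exact Complex.ext (by linarith) h2
  · left
    apply Complex.ext
    · simp only [Complex.add_re, Complex.ofReal_re]
      linarith
    · simp only [Complex.add_im, Complex.ofReal_im]
      linarith

/-- Infinitesimal version of a change of variables: a bound for `σ (-B)` by `exp (k M) σ B` for
all `B` below `M` integrates to a bound by the measure of density `exp (k t)`. -/
theorem map_neg_le_withDensity_exp {σ : Measure ℝ} {k : ℝ} (hk : 0 ≤ k)
    (h : ∀ (M : ℝ) (B : Set ℝ), MeasurableSet B → (∀ t ∈ B, t ≤ M) →
      σ ((fun t => -t) ⁻¹' B) ≤ ENNReal.ofReal (Real.exp (k * M)) * σ B) :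
    σ.map (fun t => -t) ≤ σ.withDensity fun t => ENNReal.ofReal (Real.exp (k * t)) := by
  refine Measure.le_iff.2 fun B hB => ?_
  rw [Measure.map_apply (by fun_prop) hB, withDensity_apply _ hB]
  set I := ∫⁻ t in B, ENNReal.ofReal (Real.exp (k * t)) ∂σ
  have key : ∀ ε : ℝ, 0 < ε →
      σ ((fun t => -t) ⁻¹' B) ≤ ENNReal.ofReal (Real.exp (k * ε)) * I := by
    intro ε hε
    set D : ℤ → Set ℝ := fun n => B ∩ Set.Ico (n • ε) ((n + 1) • ε)
    have hD : ∀ n, MeasurableSet (D n) := fun n => hB.inter measurableSet_Ico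
    have hU : B = ⋃ n, D n := by
      rw [← Set.inter_iUnion, iUnion_Ico_zsmul hε, Set.inter_univ]
    have hdisj : Pairwise (Function.onFun Disjoint D) := fun m n hmn =>
      (Set.pairwise_disjoint_Ico_zsmul ε hmn).mono Set.inter_subset_right Set.inter_subset_right
    have hn : ∀ n, σ ((fun t => -t) ⁻¹' D n) ≤ ENNReal.ofReal (Real.exp (k * ε)) *
        ∫⁻ t in D n, ENNReal.ofReal (Real.exp (k * t)) ∂σ := by
      intro n
      refine (h ((n + 1) • ε) (D n) (hD n) fun t ht => ht.2.2.le).trans ?_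
      have h1 : ENNReal.ofReal (Real.exp (k * (n • ε))) * σ (D n) ≤
          ∫⁻ t in D n, ENNReal.ofReal (Real.exp (k * t)) ∂σ := by
        rw [← setLIntegral_const]
        refine setLIntegral_mono' (hD n) fun t ht => ?_
        have := ht.2.1
        gcongr
      calc ENNReal.ofReal (Real.exp (k * ((n + 1) • ε))) * σ (D n)
          = ENNReal.ofReal (Real.exp (k * ε)) *
            (ENNReal.ofReal (Real.exp (k * (n • ε))) * σ (D n)) := by
            rw [← mul_assoc, ← ENNReal.ofReal_mul (Real.exp_pos _).le, ← Real.exp_add]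
            congr 3
            simp only [zsmul_eq_mul]
            push_cast
            ring_nf
        _ ≤ _ := by gcongr
    calc σ ((fun t => -t) ⁻¹' B) = σ (⋃ n, (fun t => -t) ⁻¹' D n) := by
          rw [← Set.preimage_iUnion, ← hU]
      _ ≤ ∑' n, σ ((fun t => -t) ⁻¹' D n) := measure_iUnion_le _
      _ ≤ ∑' n, ENNReal.ofReal (Real.exp (k * ε)) *
          ∫⁻ t in D n, ENNReal.ofReal (Real.exp (k * t)) ∂σ := ENNReal.tsum_le_tsum hn
      _ = ENNReal.ofReal (Real.exp (k * ε)) * I := by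
          rw [ENNReal.tsum_mul_left, ← lintegral_iUnion hD hdisj, ← hU]
  have hlim : Filter.Tendsto (fun ε : ℝ => ENNReal.ofReal (Real.exp (k * ε)) * I)
      (nhdsWithin 0 (Set.Ioi 0)) (nhds (ENNReal.ofReal (Real.exp (k * 0)) * I)) := by
    refine ENNReal.Tendsto.mul_const ?_ (.inl (by simp))
    refine ENNReal.tendsto_ofReal (Filter.Tendsto.mono_left ?_ nhdsWithin_le_nhds)
    exact Continuous.tendsto (by fun_prop) 0
  have := ge_of_tendsto hlim (Filter.eventually_of_mem self_mem_nhdsWithin key)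
  simpa using this

theorem map_neg_eq_withDensity_exp {σ : Measure ℝ} {k : ℝ} (hk : 0 ≤ k)
    (h : ∀ (M : ℝ) (B : Set ℝ), MeasurableSet B → (∀ t ∈ B, t ≤ M) →
      σ ((fun t => -t) ⁻¹' B) ≤ ENNReal.ofReal (Real.exp (k * M)) * σ B) :
    σ.map (fun t => -t) = σ.withDensity fun t => ENNReal.ofReal (Real.exp (k * t)) := by
  have hle := map_neg_le_withDensity_exp hk h
  have hneg : Measurable fun t : ℝ => -t := by fun_prop
  refine le_antisymm hle (Measure.le_iff.2 fun B hB => ?_)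
  have hBn : MeasurableSet ((fun t : ℝ => -t) ⁻¹' B) := hneg hB
  set g : ℝ → ENNReal := fun t => ENNReal.ofReal (Real.exp (k * t))
  have hg : Measurable g := by fun_prop
  have hσ : σ = (σ.map (fun t => -t)).map (fun t => -t) := by
    rw [Measure.map_map hneg hneg]
    simp
  calc σ.withDensity g B = ∫⁻ t, B.indicator g t ∂σ := by
        rw [withDensity_apply _ hB, lintegral_indicator hB]
    _ = ∫⁻ t, B.indicator g (-t) ∂(σ.map (fun t => -t)) := by
        conv_lhs => rw [hσ]
        rw [lintegral_map (hg.indicator hB) hneg]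
    _ ≤ ∫⁻ t, B.indicator g (-t) ∂(σ.withDensity g) := lintegral_mono' hle le_rfl
    _ = ∫⁻ t, g t * B.indicator g (-t) ∂σ := by
        exact lintegral_withDensity_eq_lintegral_mul _ hg ((hg.indicator hB).comp hneg)
    _ = ∫⁻ t, ((fun t : ℝ => -t) ⁻¹' B).indicator 1 t ∂σ := by
        congr 1 with t
        by_cases ht : -t ∈ B
        · have ht' : t ∈ (fun t : ℝ => -t) ⁻¹' B := ht
          rw [Set.indicator_of_mem ht, Set.indicator_of_mem ht',
            ← ENNReal.ofReal_mul (Real.exp_pos _).le, ← Real.exp_add]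
          simp
        · have ht' : t ∉ (fun t : ℝ => -t) ⁻¹' B := ht
          rw [Set.indicator_of_notMem ht, Set.indicator_of_notMem ht', mul_zero]
    _ = σ.map (fun t => -t) B := by
        rw [lintegral_indicator_one hBn, Measure.map_apply hneg hB]


section Sphere
variable {F : Type*} [NormedAddCommGroup F] [InnerProductSpace ℝ F]

/-- The map sending a point of the sphere of radius `R` about `0` to the second intersection of
the sphere with the line through that point and `x`. -/
noncomputable def sphereReflection (R : ℝ) (x y : F) : F :=
  x + (‖x‖ ^ 2 - R ^ 2) • ((1 / ‖y - x‖) ^ 2 • (y - x))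

theorem norm_sphereReflection_sub (R : ℝ) (x y : F) (hy : y ≠ x) :
    ‖sphereReflection R x y - x‖ = |‖x‖ ^ 2 - R ^ 2| / ‖y - x‖ := by
  have h : 0 < ‖y - x‖ := norm_pos_iff.2 (sub_ne_zero.2 hy)
  rw [sphereReflection, add_sub_cancel_left, norm_smul, norm_smul, Real.norm_eq_abs,
    Real.norm_of_nonneg (by positivity)]
  field_simp

theorem norm_sphereReflection {R : ℝ} (hR : 0 ≤ R) {x y : F} (hy : y ≠ x) (hyR : ‖y‖ = R) :
    ‖sphereReflection R x y‖ = R := by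
  have h : 0 < ‖y - x‖ := norm_pos_iff.2 (sub_ne_zero.2 hy)
  have h1 : ‖x + (y - x)‖ ^ 2 = R ^ 2 := by rw [add_sub_cancel, hyR]
  rw [norm_add_sq_real] at h1
  rw [← sq_eq_sq₀ (norm_nonneg _) hR, sphereReflection, norm_add_sq_real, norm_smul, norm_smul,
    inner_smul_right, inner_smul_right, Real.norm_eq_abs, Real.norm_of_nonneg (by positivity),
    mul_pow, sq_abs]
  have h2 : 2 * inner ℝ x (y - x) = R ^ 2 - ‖x‖ ^ 2 - ‖y - x‖ ^ 2 := by linarith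
  calc _ = ‖x‖ ^ 2 + (‖x‖ ^ 2 - R ^ 2) * (1 / ‖y - x‖) ^ 2 * (2 * inner ℝ x (y - x)) +
        (‖x‖ ^ 2 - R ^ 2) ^ 2 * ((1 / ‖y - x‖) ^ 2 * ‖y - x‖) ^ 2 := by ring
    _ = R ^ 2 := by
      rw [h2]
      field_simp
      ring

theorem sphereReflection_sphereReflection {R : ℝ} {x y : F} (hx : ‖x‖ ^ 2 - R ^ 2 ≠ 0)
    (hy : y ≠ x) : sphereReflection R x (sphereReflection R x y) = y := by
  have h : 0 < ‖y - x‖ := norm_pos_iff.2 (sub_ne_zero.2 hy)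
  have h1 := norm_sphereReflection_sub R x y hy
  rw [sphereReflection, h1, sphereReflection, add_sub_cancel_left, smul_smul, smul_smul, smul_smul]
  have h2 : (‖x‖ ^ 2 - R ^ 2) * (1 / (|‖x‖ ^ 2 - R ^ 2| / ‖y - x‖)) ^ 2 *
      (‖x‖ ^ 2 - R ^ 2) * (1 / ‖y - x‖) ^ 2 = 1 := by
    rw [one_div, inv_div, div_pow, sq_abs]
    field_simp
  rw [h2, one_smul, add_sub_cancel]

theorem dist_sphereReflection {R : ℝ} {x y z : F} (hy : y ≠ x) (hz : z ≠ x) :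
    dist (sphereReflection R x y) (sphereReflection R x z) =
      |‖x‖ ^ 2 - R ^ 2| / (‖y - x‖ * ‖z - x‖) * dist y z := by
  rw [sphereReflection, sphereReflection, dist_add_left, dist_smul₀,
    dist_div_norm_sq_smul (sub_ne_zero.2 hy) (sub_ne_zero.2 hz), dist_sub_right, Real.norm_eq_abs]
  ring

end Sphere

section SRatio
variable {n : ℕ} {R : ℝ} {x y : EuclideanSpace ℝ (Fin n)}

theorem abs_norm_sq_sub_sq_pos (hR : 0 < R) (hx : ‖x‖ ≠ R) : 0 < |‖x‖ ^ 2 - R ^ 2| := by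
  rw [abs_pos, sub_ne_zero]
  rwa [Ne, sq_eq_sq₀ (norm_nonneg x) hR.le]

theorem ne_of_norm_eq (hx : ‖x‖ ≠ R) (hy : ‖y‖ = R) : y ≠ x := fun h => hx (h ▸ hy)

theorem sRatio_pos (hR : 0 < R) (hx : ‖x‖ ≠ R) (hy : ‖y‖ = R) : 0 < sRatio R x y := by
  have h := abs_norm_sq_sub_sq_pos hR hx
  have h2 : 0 < ‖x - y‖ := norm_pos_iff.2 (sub_ne_zero.2 (ne_of_norm_eq hx hy).symm)
  rw [sRatio]
  positivity

theorem log_sRatio_sphereReflection (hR : 0 < R) (hx : ‖x‖ ≠ R) (hy : ‖y‖ = R) :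
    Real.log (sRatio R x (sphereReflection R x y)) = -Real.log (sRatio R x y) := by
  have h := abs_norm_sq_sub_sq_pos hR hx
  have h2 : 0 < ‖y - x‖ := norm_pos_iff.2 (sub_ne_zero.2 (ne_of_norm_eq hx hy))
  rw [← Real.log_inv, sRatio, sRatio, norm_sub_rev x, norm_sub_rev x,
    norm_sphereReflection_sub R x y (ne_of_norm_eq hx hy)]
  congr 1
  field_simp

theorem log_sRatio_le_iff (hR : 0 < R) (hx : ‖x‖ ≠ R) (hy : ‖y‖ = R) {M : ℝ} :
    Real.log (sRatio R x y) ≤ M ↔ |‖x‖ ^ 2 - R ^ 2| ≤ Real.exp M * ‖y - x‖ ^ 2 := by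
  have h2 : 0 < ‖y - x‖ := norm_pos_iff.2 (sub_ne_zero.2 (ne_of_norm_eq hx hy))
  rw [Real.log_le_iff_le_exp (sRatio_pos hR hx hy), sRatio, norm_sub_rev x,
    div_le_iff₀ (by positivity)]

theorem continuousOn_log_sRatio (hR : 0 < R) (hx : ‖x‖ ≠ R) :
    ContinuousOn (fun y => Real.log (sRatio R x y)) (Metric.sphere 0 R) := by
  refine ContinuousOn.log ?_ fun y hy => (sRatio_pos hR hx (mem_sphere_zero_iff_norm.1 hy)).ne'
  unfold sRatio
  refine ContinuousOn.div (by fun_prop) (by fun_prop) fun y hy => ?_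
  have := sub_ne_zero.2 (ne_of_norm_eq hx (mem_sphere_zero_iff_norm.1 hy)).symm
  positivity

theorem measurable_log_sRatio : Measurable fun y => Real.log (sRatio R x y) := by
  unfold sRatio
  fun_prop

theorem abs_log_sRatio_le (hR : 0 < R) (hx : ‖x‖ ≠ R) (hy : ‖y‖ = R) :
    |Real.log (sRatio R x y)| ≤ Real.log ((R + ‖x‖) / |R - ‖x‖|) := by
  have hle : ∀ {z : EuclideanSpace ℝ (Fin n)}, ‖z‖ = R →
      Real.log (sRatio R x z) ≤ Real.log ((R + ‖x‖) / |R - ‖x‖|) := by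
    intro z hz
    have h0 : 0 < |R - ‖x‖| := abs_pos.2 (sub_ne_zero.2 hx.symm)
    have h1 : |R - ‖x‖| ≤ ‖z - x‖ := hz ▸ abs_norm_sub_norm_le z x
    rw [log_sRatio_le_iff hR hx hz, Real.exp_log (by positivity)]
    have h2 : |‖x‖ ^ 2 - R ^ 2| = (R + ‖x‖) * |R - ‖x‖| := by
      rw [show ‖x‖ ^ 2 - R ^ 2 = -((R + ‖x‖) * (R - ‖x‖)) by ring, abs_neg, abs_mul,
        abs_of_pos (by positivity : 0 < R + ‖x‖)]
    rw [h2]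
    calc (R + ‖x‖) * |R - ‖x‖| = (R + ‖x‖) / |R - ‖x‖| * |R - ‖x‖| ^ 2 := by field_simp
      _ ≤ _ := by gcongr
  refine abs_le.2 ⟨?_, hle hy⟩
  have := hle (norm_sphereReflection hR.le (ne_of_norm_eq hx hy) hy)
  rw [log_sRatio_sphereReflection hR hx hy] at this
  linarith

theorem log_sRatio_smul (hR : 0 < R) (hx0 : 0 < ‖x‖) (hx : ‖x‖ ≠ R) :
    Real.log (sRatio R x ((R / ‖x‖) • x)) = Real.log ((R + ‖x‖) / |R - ‖x‖|) := by
  have h0 : 0 < |R - ‖x‖| := abs_pos.2 (sub_ne_zero.2 hx.symm)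
  have h1 : x - (R / ‖x‖) • x = ((‖x‖ - R) / ‖x‖) • x := by
    rw [sub_div, div_self hx0.ne', sub_smul, one_smul]
  have h2 : |‖x‖ ^ 2 - R ^ 2| = (R + ‖x‖) * |R - ‖x‖| := by
    rw [show ‖x‖ ^ 2 - R ^ 2 = -((R + ‖x‖) * (R - ‖x‖)) by ring, abs_neg, abs_mul,
      abs_of_pos (by positivity : 0 < R + ‖x‖)]
  rw [sRatio, h1, norm_smul, h2, norm_div, norm_norm, Real.norm_eq_abs, abs_sub_comm ‖x‖ R]
  congr 1
  field_simp

theorem exists_log_sRatio_mem_Ioo (hn : 2 ≤ n) (hR : 0 < R) (hx0 : 0 < ‖x‖) (hx : ‖x‖ ≠ R) :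
    ∃ y : EuclideanSpace ℝ (Fin n), ‖y‖ = R ∧
      Real.log (sRatio R x y) ∈ Set.Ioo 0 (Real.log ((R + ‖x‖) / |R - ‖x‖|)) := by
  set L := Real.log ((R + ‖x‖) / |R - ‖x‖|)
  have hL : 0 < L := by
    refine Real.log_pos ?_
    rw [one_lt_div (abs_pos.2 (sub_ne_zero.2 hx.symm)), abs_lt]
    constructor <;> linarith
  have hp : ‖(R / ‖x‖) • x‖ = R := by
    rw [norm_smul, Real.norm_of_nonneg (by positivity)]
    field_simp
  have hconn : IsPreconnected (Metric.sphere (0 : EuclideanSpace ℝ (Fin n)) R) := by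
    refine isPreconnected_sphere ?_ 0 R
    rw [← Module.finrank_eq_rank]
    simp
    omega
  have hsub := hconn.intermediate_value
    (mem_sphere_zero_iff_norm.2 (norm_sphereReflection hR.le (ne_of_norm_eq hx hp) hp))
    (mem_sphere_zero_iff_norm.2 hp) (continuousOn_log_sRatio hR hx)
  rw [log_sRatio_sphereReflection hR hx hp, log_sRatio_smul hR hx0 hx] at hsub
  obtain ⟨y, hy, hyL⟩ := hsub (show L / 2 ∈ Set.Icc (-L) L by constructor <;> linarith)
  refine ⟨y, mem_sphere_zero_iff_norm.1 hy, ?_⟩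
  simp only at hyL
  rw [hyL]
  constructor <;> linarith

theorem hausdorffMeasure_sphere_log_sRatio_neg_le {d : ℝ} (hd : 0 ≤ d) (hR : 0 < R) (hx : ‖x‖ ≠ R)
    (M : ℝ) {B : Set ℝ} (hB : ∀ t ∈ B, t ≤ M) :
    μH[d] {y | -Real.log (sRatio R x y) ∈ B ∧ ‖y‖ = R} ≤
      ENNReal.ofReal (Real.exp (d * M)) * μH[d] {y | Real.log (sRatio R x y) ∈ B ∧ ‖y‖ = R} := by
  set A := {y | Real.log (sRatio R x y) ∈ B ∧ ‖y‖ = R}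
  have hc := abs_norm_sq_sub_sq_pos hR hx
  have hlip : LipschitzOnWith (Real.exp M).toNNReal (sphereReflection R x) A := by
    refine LipschitzOnWith.of_dist_le_mul fun y hy z hz => ?_
    have hyx := ne_of_norm_eq hx hy.2
    have hzx := ne_of_norm_eq hx hz.2
    have hy0 : 0 < ‖y - x‖ := norm_pos_iff.2 (sub_ne_zero.2 hyx)
    have hz0 : 0 < ‖z - x‖ := norm_pos_iff.2 (sub_ne_zero.2 hzx)
    have h1 := (log_sRatio_le_iff hR hx hy.2).1 (hB _ hy.1)
    have h2 := (log_sRatio_le_iff hR hx hz.2).1 (hB _ hz.1)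
    rw [dist_sphereReflection hyx hzx, Real.coe_toNNReal _ (Real.exp_pos M).le]
    refine mul_le_mul_of_nonneg_right ?_ dist_nonneg
    rw [div_le_iff₀ (by positivity), ← sq_le_sq₀ hc.le (by positivity)]
    calc _ = |‖x‖ ^ 2 - R ^ 2| * |‖x‖ ^ 2 - R ^ 2| := sq _
      _ ≤ (Real.exp M * ‖y - x‖ ^ 2) * (Real.exp M * ‖z - x‖ ^ 2) := by gcongr
      _ = _ := by ring
  have hsub : {y | -Real.log (sRatio R x y) ∈ B ∧ ‖y‖ = R} ⊆ sphereReflection R x '' A := by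
    rintro y ⟨hy, hyR⟩
    refine ⟨sphereReflection R x y, ⟨?_, ?_⟩, ?_⟩
    · rwa [log_sRatio_sphereReflection hR hx hyR]
    · exact norm_sphereReflection hR.le (ne_of_norm_eq hx hyR) hyR
    · exact sphereReflection_sphereReflection (abs_pos.1 hc) (ne_of_norm_eq hx hyR)
  refine (measure_mono hsub).trans ((hlip.hausdorffMeasure_image_le hd).trans_eq ?_)
  congr 1
  rw [mul_comm, Real.exp_mul, ← ENNReal.ofReal_rpow_of_pos (Real.exp_pos M)]
  rfl

end SRatio

section HausdorffMeasureSphere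
variable {k : ℕ}

theorem lipschitzOnWith_inv_norm_smul {F : Type*} [NormedAddCommGroup F] [NormedSpace ℝ F] :
    LipschitzOnWith 2 (fun v : F => ‖v‖⁻¹ • v) {v | 1 ≤ ‖v‖} := by
  refine LipschitzOnWith.of_dist_le_mul fun v (hv : 1 ≤ ‖v‖) w (hw : 1 ≤ ‖w‖) => ?_
  have hv0 : 0 < ‖v‖ := by linarith
  have hw0 : 0 < ‖w‖ := by linarith
  have h1 : ‖v‖⁻¹ • v - ‖w‖⁻¹ • w = ‖v‖⁻¹ • (v - w) + (‖v‖⁻¹ - ‖w‖⁻¹) • w := by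
    rw [smul_sub, sub_smul]
    abel
  have h2 : |‖v‖⁻¹ - ‖w‖⁻¹| * ‖w‖ = ‖v‖⁻¹ * |‖w‖ - ‖v‖| := by
    rw [inv_sub_inv hv0.ne' hw0.ne', abs_div, abs_of_pos (mul_pos hv0 hw0)]
    field_simp
  have h3 : |‖w‖ - ‖v‖| ≤ ‖v - w‖ := norm_sub_rev v w ▸ abs_norm_sub_norm_le w v
  have h4 : ‖v‖⁻¹ ≤ 1 := inv_le_one_of_one_le₀ hv
  rw [dist_eq_norm, dist_eq_norm, h1]
  refine (norm_add_le _ _).trans ?_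
  rw [norm_smul, norm_smul, Real.norm_eq_abs (_ - _), h2, norm_inv, norm_norm]
  have h5 : ‖v‖⁻¹ * ‖v - w‖ ≤ 1 * ‖v - w‖ := by gcongr
  have h6 : ‖v‖⁻¹ * |‖w‖ - ‖v‖| ≤ 1 * ‖v - w‖ := by gcongr
  push_cast
  linarith

theorem hausdorffMeasure_sphere_lt_top {R : ℝ} (hR : R ≠ 0) :
    μH[(k : ℝ)] (Metric.sphere (0 : EuclideanSpace ℝ (Fin (k + 1))) R) < ⊤ := by
  set Q : Set (Fin k → ℝ) := Metric.closedBall 0 1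
  set face : Fin (k + 1) → (Fin k → ℝ) → EuclideanSpace ℝ (Fin (k + 1)) :=
    fun i w => WithLp.toLp 2 (i.insertNth 1 w)
  have hface : ∀ i w, 1 ≤ ‖face i w‖ := by
    intro i w
    have := PiLp.norm_apply_le (face i w) i
    simpa [face] using this
  have hlip : ∀ i (s : ℝ), ∃ K, LipschitzOnWith K
      (fun w => s • (‖face i w‖⁻¹ • face i w)) Q := by
    intro i s
    have h1 : LipschitzWith 1 fun w : Fin k → ℝ => (i.insertNth 1 w : Fin (k + 1) → ℝ) := by
      refine LipschitzWith.of_dist_le_mul fun v w => ?_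
      rw [Fin.dist_insertNth_insertNth]
      simp
    have h2 := ((PiLp.lipschitzWith_toLp 2 fun _ : Fin (k + 1) => ℝ).comp h1)
    have h3 := (lipschitzOnWith_inv_norm_smul (F := EuclideanSpace ℝ (Fin (k + 1)))).comp
      (h2.lipschitzOnWith (s := Q)) fun w _ => hface i w
    exact ⟨_, (lipschitzWith_smul s).comp_lipschitzOnWith h3⟩
  have hfin : ∀ i (s : ℝ), μH[(k : ℝ)] ((fun w => s • (‖face i w‖⁻¹ • face i w)) '' Q) < ⊤ := by
    intro i s
    obtain ⟨K, hK⟩ := hlip i s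
    refine (hK.hausdorffMeasure_image_le (Nat.cast_nonneg k)).trans_lt ?_
    refine ENNReal.mul_lt_top (ENNReal.rpow_lt_top_of_nonneg (Nat.cast_nonneg k)
      ENNReal.coe_ne_top) ?_
    have := hausdorffMeasure_pi_real (ι := Fin k)
    rw [Fintype.card_fin] at this
    rw [this]
    exact measure_closedBall_lt_top
  have hcov : Metric.sphere (0 : EuclideanSpace ℝ (Fin (k + 1))) R ⊆
      ⋃ i, ((fun w => R • (‖face i w‖⁻¹ • face i w)) '' Q ∪
        (fun w => (-R) • (‖face i w‖⁻¹ • face i w)) '' Q) := by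
    intro y hy
    rw [mem_sphere_zero_iff_norm] at hy
    obtain ⟨i, hi⟩ := Finite.exists_max fun j => |y j|
    have hyi : y i ≠ 0 := by
      intro h0
      apply hR
      rw [← hy, norm_eq_zero]
      ext j
      have := hi j
      simpa [h0] using this
    have hf : face i (fun j => y (i.succAbove j) / y i) = (y i)⁻¹ • y := by
      ext j
      refine Fin.succAboveCases i ?_ (fun j => ?_) j <;> simp [face, hyi]
      field_simp
    have hQ : (fun j => y (i.succAbove j) / y i) ∈ Q := by
      rw [mem_closedBall_zero_iff, pi_norm_le_iff_of_nonneg zero_le_one]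
      intro j
      rw [Real.norm_eq_abs, abs_div]
      exact div_le_one_of_le₀ (hi _) (abs_nonneg _)
    have hval : ∀ s : ℝ, s * (|y i| * R⁻¹) * (y i)⁻¹ = 1 → s •
        (‖face i (fun j => y (i.succAbove j) / y i)‖⁻¹ •
          face i (fun j => y (i.succAbove j) / y i)) = y := by
      intro s hs
      rw [hf, norm_smul, hy, norm_inv, Real.norm_eq_abs, smul_smul, smul_smul, mul_inv, inv_inv,
        hs, one_smul]
    refine Set.mem_iUnion.2 ⟨i, ?_⟩
    rcases hyi.lt_or_gt with hlt | hlt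
    · refine .inr ⟨_, hQ, hval _ ?_⟩
      rw [abs_of_neg hlt]
      field_simp
    · refine .inl ⟨_, hQ, hval _ ?_⟩
      rw [abs_of_pos hlt]
      field_simp
  refine (measure_mono hcov).trans_lt ((measure_iUnion_le _).trans_lt ?_)
  rw [tsum_fintype]
  exact ENNReal.sum_lt_top.2 fun i _ => (measure_union_le _ _).trans_lt
    (ENNReal.add_lt_top.2 ⟨hfin i R, hfin i (-R)⟩)

theorem hausdorffMeasure_inter_sphere_pos {R : ℝ} (hR : 0 < R)
    {U : Set (EuclideanSpace ℝ (Fin (k + 1)))} {y : EuclideanSpace ℝ (Fin (k + 1))}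
    (hy : ‖y‖ = R) (hU : U ∈ nhdsWithin y (Metric.sphere 0 R)) :
    0 < μH[(k : ℝ)] (U ∩ Metric.sphere 0 R) := by
  obtain ⟨i, hi⟩ : ∃ i, y i ≠ 0 := by
    by_contra! h
    have : y = 0 := by
      ext j
      exact h j
    rw [this, norm_zero] at hy
    exact hR.ne hy
  set p : EuclideanSpace ℝ (Fin (k + 1)) → Fin k → ℝ := fun z j => z (i.succAbove j)
  have hp : LipschitzWith 1 p := by
    refine LipschitzWith.of_dist_le_mul fun v w => ?_
    rw [dist_pi_le_iff (by positivity)]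
    intro j
    have := PiLp.norm_apply_le (v - w) (i.succAbove j)
    simpa [p, dist_eq_norm] using this
  have hnorm : ∀ z : EuclideanSpace ℝ (Fin (k + 1)), ‖z‖ ^ 2 = z i ^ 2 + ∑ j, p z j ^ 2 := by
    intro z
    rw [EuclideanSpace.real_norm_sq_eq, Fin.sum_univ_succAbove _ i]
  set s : ℝ := ((SignType.sign (y i) : SignType) : ℝ)
  set lift : (Fin k → ℝ) → EuclideanSpace ℝ (Fin (k + 1)) :=
    fun w => WithLp.toLp 2 (i.insertNth (s * √(R ^ 2 - ∑ j, w j ^ 2)) w)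
  have hlift : Continuous lift := by
    refine (PiLp.continuous_toLp 2 _).comp ?_
    refine Continuous.finInsertNth i ?_ continuous_id
    fun_prop
  have hplift : ∀ w, p (lift w) = w := by
    intro w
    ext j
    simp [p, lift]
  have hsq : R ^ 2 - ∑ j, p y j ^ 2 = y i ^ 2 := by
    rw [← hy, hnorm]
    ring
  have hy0 : lift (p y) = y := by
    ext j
    refine Fin.succAboveCases i ?_ (fun j => ?_) j
    · simp [lift, hsq, s, Real.sqrt_sq_eq_abs]
    · simp [lift, p]
  have hs : s ^ 2 = 1 := by
    rcases hi.lt_or_gt with h | h <;> simp [s, h]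
  have hsphere : ∀ᶠ w in nhds (p y), lift w ∈ Metric.sphere 0 R := by
    have : ∀ᶠ w : Fin k → ℝ in nhds (p y), 0 < R ^ 2 - ∑ j, w j ^ 2 := by
      refine ContinuousAt.eventually_lt continuousAt_const (Continuous.continuousAt (by fun_prop)) ?_
      rw [hsq]
      positivity
    filter_upwards [this] with w hw
    rw [mem_sphere_zero_iff_norm, ← sq_eq_sq₀ (norm_nonneg _) hR.le, hnorm, hplift]
    simp [lift, mul_pow, hs, Real.sq_sqrt hw.le]
  have htend : Filter.Tendsto lift (nhds (p y)) (nhdsWithin y (Metric.sphere 0 R)) := by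
    refine tendsto_nhdsWithin_iff.2 ⟨?_, hsphere⟩
    simpa only [hy0] using hlift.tendsto (p y)
  have hV : p '' (U ∩ Metric.sphere 0 R) ∈ nhds (p y) := by
    filter_upwards [htend hU, hsphere] with w h1 h2
    exact ⟨lift w, ⟨h1, h2⟩, hplift w⟩
  have hvol := hausdorffMeasure_pi_real (ι := Fin k)
  rw [Fintype.card_fin] at hvol
  calc 0 < volume (p '' (U ∩ Metric.sphere 0 R)) := Measure.measure_pos_of_mem_nhds volume hV
    _ = μH[(k : ℝ)] (p '' (U ∩ Metric.sphere 0 R)) := by rw [hvol]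
    _ ≤ μH[(k : ℝ)] (U ∩ Metric.sphere 0 R) := by
        simpa using hp.hausdorffMeasure_image_le (Nat.cast_nonneg k) (U ∩ Metric.sphere 0 R)

end HausdorffMeasureSphere

theorem stmt_3 (k : ℕ) (hk : 1 ≤ k) (R : ℝ) (hR : 0 < R)
    (x : EuclideanSpace ℝ (Fin (k + 1))) (hx0 : 0 < ‖x‖) (hx : ‖x‖ ≠ R)
    (α β : ℂ)
    (him : max |α.im| |β.im| ≤ (Real.pi / 2) / Real.log ((R + ‖x‖) / |R - ‖x‖|))
    (h : ∫ y in Metric.sphere (0 : EuclideanSpace ℝ (Fin (k + 1))) R,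
            Complex.exp (α * (Real.log (sRatio R x y) : ℂ)) ∂(μH[(k : ℝ)]) =
         ∫ y in Metric.sphere (0 : EuclideanSpace ℝ (Fin (k + 1))) R,
            Complex.exp (β * (Real.log (sRatio R x y) : ℂ)) ∂(μH[(k : ℝ)])) :
    α + β = (k : ℂ) ∨ α = β := by
  set L := Real.log ((R + ‖x‖) / |R - ‖x‖|)
  set S := Metric.sphere (0 : EuclideanSpace ℝ (Fin (k + 1))) R
  set u : EuclideanSpace ℝ (Fin (k + 1)) → ℝ := fun y => Real.log (sRatio R x y)
  have hu : Measurable u := measurable_log_sRatio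
  have hS : MeasurableSet S := Metric.isClosed_sphere.measurableSet
  obtain ⟨y, hy, hyL⟩ := exists_log_sRatio_mem_Ioo (by omega : 2 ≤ k + 1) hR hx0 hx
  have hL : 0 < L := hyL.1.trans hyL.2
  set μ := (μH[(k : ℝ)] : Measure (EuclideanSpace ℝ (Fin (k + 1)))).restrict S
  have : IsFiniteMeasure μ :=
    ⟨by rw [Measure.restrict_apply_univ]; exact hausdorffMeasure_sphere_lt_top hR.ne'⟩
  set σ := μ.map u
  have hσ : ∀ {B : Set ℝ}, MeasurableSet B → σ B = μH[(k : ℝ)] (u ⁻¹' B ∩ S) := by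
    intro B hB
    rw [Measure.map_apply hu hB, Measure.restrict_apply (hu hB)]
  have hsupp : ∀ᵐ t ∂σ, |t| ≤ L := by
    rw [ae_map_iff hu.aemeasurable (measurableSet_le (by fun_prop) (by fun_prop))]
    filter_upwards [ae_restrict_mem hS] with z hz
    exact abs_log_sRatio_le hR hx (mem_sphere_zero_iff_norm.1 hz)
  have hpos : σ {t | 0 < |t| ∧ |t| < L} ≠ 0 := by
    have hsub : Set.Ioo 0 L ⊆ {t | 0 < |t| ∧ |t| < L} := fun t ht => by
      rw [Set.mem_ofPred_eq, abs_of_pos ht.1]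
      exact ht
    refine (lt_of_lt_of_le ?_ (measure_mono hsub)).ne'
    rw [hσ measurableSet_Ioo]
    exact hausdorffMeasure_inter_sphere_pos hR hy
      (continuousOn_log_sRatio hR hx y (mem_sphere_zero_iff_norm.2 hy) (isOpen_Ioo.mem_nhds hyL))
  have hsymm : σ.map (fun t => -t) =
      σ.withDensity fun t => ENNReal.ofReal (Real.exp ((k : ℝ) * t)) := by
    refine map_neg_eq_withDensity_exp (Nat.cast_nonneg k) fun M B hB hBM => ?_
    rw [hσ hB, hσ (measurable_neg hB)]
    have := hausdorffMeasure_sphere_log_sRatio_neg_le (Nat.cast_nonneg k) hR hx M hBM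
    convert this using 3 <;> ext z <;> simp [u, S]
  have hmap : ∀ γ : ℂ, ∫ t : ℝ, Complex.exp (γ * t) ∂σ = ∫ y, Complex.exp (γ * u y) ∂μ :=
    fun γ => integral_map hu.aemeasurable (Continuous.aestronglyMeasurable (by fun_prop))
  have hbound := (le_div_iff₀ hL).1 him
  rw [max_mul_of_nonneg _ _ hL.le, max_le_iff] at hbound
  have := add_eq_or_eq_of_integral_cexp_eq hsupp hpos hsymm hbound.1 hbound.2
    (by rw [hmap, hmap]; exact h)
  simpa using this
end

section
/- Let k ≥ 1 be an integer, R > 0, and let x ∈ ℝ^{k+1} be a fixed point with |x| ≠ R. Then for every real number b and every natural number m = 0, 1, 2, ..., one has ∫_{S^k(R)} ω(x,y)^{k/2} (ln ω(x,y))^{2m+1} cos(b · ln ω(x,y)) dS_y = 0 and ∫_{S^k(R)} ω(x,y)^{k/2} (ln ω(x,y))^{2m} sin(b · ln ω(x,y)) dS_y = 0. -/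
open MeasureTheory

open scoped NNReal ENNReal

/-- A set on which the conformal factor `w` is bounded by `c` is mapped in a `c`-Lipschitz way. -/
theorem lipschitzOnWith_of_dist_sq_eq {X : Type*} [PseudoMetricSpace X] {f : X → X} {w : X → ℝ≥0}
    {S : Set X} {c : ℝ≥0}
    (hd : ∀ y ∈ S, ∀ z ∈ S, dist (f y) (f z) ^ 2 = w y * w z * dist y z ^ 2)
    (hw : ∀ y ∈ S, w y ≤ c) : LipschitzOnWith c f S := by
  refine LipschitzOnWith.of_dist_le_mul fun y hy z hz => ?_
  refine le_of_sq_le_sq ?_ (by positivity)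
  rw [hd y hy z hz, mul_pow, sq (c : ℝ)]
  have hy' : (w y : ℝ) ≤ c := by exact_mod_cast hw y hy
  have hz' : (w z : ℝ) ≤ c := by exact_mod_cast hw z hz
  gcongr

section ConformalInvolution

variable {X : Type*} [MetricSpace X] [MeasurableSpace X] [BorelSpace X] {f : X → X} {w : X → ℝ≥0}
  {S : Set X}

/-- The pushforward of the Hausdorff measure under a conformal involution with conformal factor `w`
is bounded by the measure with density `w ^ k`. -/
theorem map_hausdorffMeasure_restrict_le (k : ℕ) (hf : Measurable f)
    (hw : Measurable w) (hmaps : ∀ y ∈ S, f y ∈ S) (hinv : ∀ y ∈ S, f (f y) = y)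
    (hpos : ∀ y ∈ S, w y ≠ 0)
    (hd : ∀ y ∈ S, ∀ z ∈ S, dist (f y) (f z) ^ 2 = w y * w z * dist y z ^ 2) :
    (μH[(k : ℝ)].restrict S).map f ≤
      (μH[(k : ℝ)].restrict S).withDensity fun y => ((w y ^ k : ℝ≥0) : ℝ≥0∞) := by
  have hw' : Measurable fun y => (w y : ℝ≥0∞) := hw.coe_nnreal_ennreal
  have hwk : Measurable fun y => ((w y ^ k : ℝ≥0) : ℝ≥0∞) := (hw.pow_const k).coe_nnreal_ennreal
  refine Measure.le_iff.2 fun A hA => ?_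
  have himage : ∀ B, MeasurableSet B →
      (μH[(k : ℝ)].restrict S).map f B = μH[(k : ℝ)] (f '' (B ∩ S)) := by
    intro B hB
    rw [Measure.map_apply hf hB, Measure.restrict_apply (hf hB)]
    congr 1
    ext y
    constructor
    · rintro ⟨h1, h2⟩
      exact ⟨f y, ⟨h1, hmaps y h2⟩, hinv y h2⟩
    · rintro ⟨z, ⟨h1, h2⟩, rfl⟩
      exact ⟨by simpa [hinv z h2] using h1, hmaps z h2⟩
  have hscale : ∀ t : ℝ≥0, 1 < t →
      (μH[(k : ℝ)].restrict S).map f A ≤ ((t ^ k : ℝ≥0) : ℝ≥0∞) *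
        (μH[(k : ℝ)].restrict S).withDensity (fun y => ((w y ^ k : ℝ≥0) : ℝ≥0∞)) A := by
    intro t ht
    have ht0 : t ≠ 0 := (zero_lt_one.trans ht).ne'
    rw [measure_eq_measure_preimage_add_measure_tsum_Ico_zpow _ hw' hA ht,
      measure_eq_measure_preimage_add_measure_tsum_Ico_zpow
        ((μH[(k : ℝ)].restrict S).withDensity fun y => ((w y ^ k : ℝ≥0) : ℝ≥0∞)) hw' hA ht]
    have hzero : (μH[(k : ℝ)].restrict S).map f (A ∩ (fun y => (w y : ℝ≥0∞)) ⁻¹' {0}) = 0 := by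
      rw [himage _ (hA.inter (hw' (measurableSet_singleton _)))]
      convert measure_empty (μ := μH[(k : ℝ)])
      rw [Set.image_eq_empty, Set.eq_empty_iff_forall_notMem]
      rintro y ⟨⟨-, h⟩, hy⟩
      exact hpos y hy (by simpa using h)
    have htop : A ∩ (fun y => (w y : ℝ≥0∞)) ⁻¹' {∞} = ∅ := by
      ext y; simp
    rw [hzero, htop, measure_empty, zero_add, zero_add, mul_add, ← ENNReal.tsum_mul_left]
    refine le_trans (ENNReal.tsum_le_tsum fun n => ?_) le_add_self
    set B := A ∩ (fun y => (w y : ℝ≥0∞)) ⁻¹' Set.Ico ((t : ℝ≥0∞) ^ n) ((t : ℝ≥0∞) ^ (n + 1))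
      with hBdef
    have hB : MeasurableSet B := hA.inter (hw' measurableSet_Ico)
    have hbounds : ∀ y ∈ B, t ^ n ≤ w y ∧ w y ≤ t ^ (n + 1) := by
      rintro y ⟨-, h1, h2⟩
      rw [← ENNReal.coe_zpow ht0] at h1 h2
      exact ⟨ENNReal.coe_le_coe.1 h1, ENNReal.coe_le_coe.1 h2.le⟩
    have hlip : LipschitzOnWith (t ^ (n + 1)) f (B ∩ S) :=
      lipschitzOnWith_of_dist_sq_eq (w := w) (fun y hy z hz => hd y hy.2 z hz.2)
        fun y hy => (hbounds y hy.1).2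
    have hle := hlip.hausdorffMeasure_image_le (d := (k : ℝ)) (Nat.cast_nonneg k)
    rw [himage B hB]
    refine hle.trans ?_
    rw [withDensity_apply _ hB, ENNReal.rpow_natCast, ← ENNReal.coe_pow]
    have hint : ((((t ^ n) ^ k : ℝ≥0)) : ℝ≥0∞) * μH[(k : ℝ)] (B ∩ S) ≤
        ∫⁻ y in B, ((w y ^ k : ℝ≥0) : ℝ≥0∞) ∂(μH[(k : ℝ)].restrict S) := by
      rw [← Measure.restrict_apply hB, ← setLIntegral_const]
      refine setLIntegral_mono hwk fun y hy => ?_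
      have := (hbounds y hy).1
      gcongr
    calc (((t ^ (n + 1)) ^ k : ℝ≥0) : ℝ≥0∞) * μH[(k : ℝ)] (B ∩ S)
        = ((t ^ k : ℝ≥0) : ℝ≥0∞) * ((((t ^ n) ^ k : ℝ≥0) : ℝ≥0∞) * μH[(k : ℝ)] (B ∩ S)) := by
          rw [← mul_assoc, ← ENNReal.coe_mul, ← mul_pow, zpow_add_one₀ ht0, mul_comm t]
      _ ≤ _ := by gcongr
  have hlim : Filter.Tendsto (fun t : ℝ≥0 => ((t ^ k : ℝ≥0) : ℝ≥0∞) *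
      (μH[(k : ℝ)].restrict S).withDensity (fun y => ((w y ^ k : ℝ≥0) : ℝ≥0∞)) A)
      (nhdsWithin 1 (Set.Ioi 1))
      (nhds ((((1 : ℝ≥0) ^ k : ℝ≥0) : ℝ≥0∞) *
        (μH[(k : ℝ)].restrict S).withDensity (fun y => ((w y ^ k : ℝ≥0) : ℝ≥0∞)) A)) := by
    refine ENNReal.Tendsto.mul_const ?_ (Or.inl (by simp))
    refine ENNReal.tendsto_coe.2 (Filter.Tendsto.mono_left ?_ nhdsWithin_le_nhds)
    exact (continuous_pow k).tendsto 1
  simpa using ge_of_tendsto hlim (Filter.eventually_of_mem self_mem_nhdsWithin hscale)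

/-- The pushforward of the Hausdorff measure under a conformal involution with conformal factor `w`
is the measure with density `w ^ k`. -/
theorem map_hausdorffMeasure_restrict_eq (k : ℕ) (hS : MeasurableSet S) (hf : Measurable f)
    (hw : Measurable w) (hmaps : ∀ y ∈ S, f y ∈ S) (hinv : ∀ y ∈ S, f (f y) = y)
    (hpos : ∀ y ∈ S, w y ≠ 0) (hwf : ∀ y ∈ S, w (f y) = (w y)⁻¹)
    (hd : ∀ y ∈ S, ∀ z ∈ S, dist (f y) (f z) ^ 2 = w y * w z * dist y z ^ 2) :
    (μH[(k : ℝ)].restrict S).map f =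
      (μH[(k : ℝ)].restrict S).withDensity fun y => ((w y ^ k : ℝ≥0) : ℝ≥0∞) := by
  have hle := map_hausdorffMeasure_restrict_le k hf hw hmaps hinv hpos hd
  have hwk : Measurable fun y => ((w y ^ k : ℝ≥0) : ℝ≥0∞) := (hw.pow_const k).coe_nnreal_ennreal
  refine le_antisymm hle (Measure.le_iff.2 fun A hA => ?_)
  have hG : Measurable fun y => (f ⁻¹' A).indicator (fun y => (((w y)⁻¹ ^ k : ℝ≥0) : ℝ≥0∞)) y :=
    Measurable.indicator (hw.inv.pow_const k).coe_nnreal_ennreal (hf hA)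
  have key := lintegral_mono' hle
    (le_refl fun y => (f ⁻¹' A).indicator (fun y => (((w y)⁻¹ ^ k : ℝ≥0) : ℝ≥0∞)) y)
  rw [lintegral_map hG hf, lintegral_withDensity_eq_lintegral_mul _ hwk hG] at key
  rw [withDensity_apply _ hA, ← lintegral_indicator hA, Measure.map_apply hf hA]
  calc _ = _ := setLIntegral_congr_fun hS fun y hy => ?_
    _ ≤ _ := key
    _ = ∫⁻ y in S, (f ⁻¹' A).indicator 1 y ∂μH[(k : ℝ)] := setLIntegral_congr_fun hS fun y hy => ?_
    _ = _ := lintegral_indicator_one (hf hA)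
  · have hmem : f y ∈ f ⁻¹' A ↔ y ∈ A := by rw [Set.mem_preimage, hinv y hy]
    by_cases hyA : y ∈ A
    · simp only [Set.indicator_of_mem hyA, Set.indicator_of_mem (hmem.2 hyA), hwf y hy, inv_inv]
    · simp only [Set.indicator_of_notMem hyA, Set.indicator_of_notMem (mt hmem.1 hyA)]
  · simp only [Set.indicator, Set.mem_preimage, Pi.mul_apply, Pi.one_apply]
    split_ifs
    · rw [← ENNReal.coe_mul, ← mul_pow, mul_inv_cancel₀ (hpos y hy), one_pow, ENNReal.coe_one]
    · simp

/-- Change of variables under a conformal involution. -/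
theorem integral_comp_conformal_involution (k : ℕ) (hS : MeasurableSet S) (hf : Measurable f)
    (hw : Measurable w) (hmaps : ∀ y ∈ S, f y ∈ S) (hinv : ∀ y ∈ S, f (f y) = y)
    (hpos : ∀ y ∈ S, w y ≠ 0) (hwf : ∀ y ∈ S, w (f y) = (w y)⁻¹)
    (hd : ∀ y ∈ S, ∀ z ∈ S, dist (f y) (f z) ^ 2 = w y * w z * dist y z ^ 2)
    {g : X → ℝ} (hg : Measurable g) :
    ∫ y in S, g (f y) ∂μH[(k : ℝ)] = ∫ y in S, (w y : ℝ) ^ k * g y ∂μH[(k : ℝ)] := by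
  rw [← integral_map hf.aemeasurable hg.aestronglyMeasurable,
    map_hausdorffMeasure_restrict_eq k hS hf hw hmaps hinv hpos hwf hd,
    integral_withDensity_eq_integral_smul (hw.pow_const k)]
  simp [NNReal.smul_def]

/-- If `g` is odd, then the integral of `w ^ (k / 2) * g (log w)` against the Hausdorff measure
on a set with a conformal involution with conformal factor `w` vanishes. -/
theorem integral_rpow_mul_odd_log_eq_zero (k : ℕ) (hS : MeasurableSet S) (hf : Measurable f)
    (hw : Measurable w) (hmaps : ∀ y ∈ S, f y ∈ S) (hinv : ∀ y ∈ S, f (f y) = y)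
    (hpos : ∀ y ∈ S, w y ≠ 0) (hwf : ∀ y ∈ S, w (f y) = (w y)⁻¹)
    (hd : ∀ y ∈ S, ∀ z ∈ S, dist (f y) (f z) ^ 2 = w y * w z * dist y z ^ 2)
    {g : ℝ → ℝ} (hg : Measurable g) (hodd : ∀ s, g (-s) = -g s) :
    ∫ y in S, (w y : ℝ) ^ ((k : ℝ) / 2) * g (Real.log (w y)) ∂μH[(k : ℝ)] = 0 := by
  have hwr : Measurable fun y => (w y : ℝ) := hw.coe_nnreal_real
  have hG : Measurable fun y => (w y : ℝ) ^ ((k : ℝ) / 2) * g (Real.log (w y)) :=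
    (hwr.pow_const _).mul (hg.comp (Real.measurable_log.comp hwr))
  have key := integral_comp_conformal_involution k hS hf hw hmaps hinv hpos hwf hd
    (hG.comp hf)
  have h1 : ∫ y in S, (w (f (f y)) : ℝ) ^ ((k : ℝ) / 2) * g (Real.log (w (f (f y)))) ∂μH[(k : ℝ)] =
      ∫ y in S, (w y : ℝ) ^ ((k : ℝ) / 2) * g (Real.log (w y)) ∂μH[(k : ℝ)] :=
    setIntegral_congr_fun hS fun y hy => by simp only [hinv y hy]
  have h2 : ∫ y in S, (w y : ℝ) ^ k *
        ((w (f y) : ℝ) ^ ((k : ℝ) / 2) * g (Real.log (w (f y)))) ∂μH[(k : ℝ)] =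
      ∫ y in S, -((w y : ℝ) ^ ((k : ℝ) / 2) * g (Real.log (w y))) ∂μH[(k : ℝ)] := by
    refine setIntegral_congr_fun hS fun y hy => ?_
    have hp : 0 < (w y : ℝ) := by exact_mod_cast pos_iff_ne_zero.2 (hpos y hy)
    have hk : (w y : ℝ) ^ k = (w y : ℝ) ^ ((k : ℝ) / 2) * (w y : ℝ) ^ ((k : ℝ) / 2) := by
      rw [← Real.rpow_add hp, add_halves, Real.rpow_natCast]
    have hne : (w y : ℝ) ^ ((k : ℝ) / 2) ≠ 0 := (Real.rpow_pos_of_pos hp _).ne'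
    simp only [hwf y hy, NNReal.coe_inv, Real.log_inv, hodd, Real.inv_rpow hp.le, hk]
    field_simp
  rw [integral_neg] at h2
  have h3 := h1.symm.trans (key.trans h2)
  linarith

end ConformalInvolution

section SecondIntersection

variable {E : Type*} [NormedAddCommGroup E] [InnerProductSpace ℝ E]

/-- The inversion centered at `x` with (possibly negative) power `P`. If `P = ‖x‖ ^ 2 - R ^ 2`, it
sends a point `y` of the sphere of radius `R` to the second intersection of the line through
`x` and `y` with the sphere. -/
noncomputable def powerInversion (x : E) (P : ℝ) (y : E) : E :=
  x + (P / ‖y - x‖ ^ 2) • (y - x)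

theorem norm_powerInversion_sub (x : E) (P : ℝ) {y : E} (hy : y ≠ x) :
    ‖powerInversion x P y - x‖ = |P| / ‖y - x‖ := by
  have h : ‖y - x‖ ≠ 0 := norm_ne_zero_iff.2 (sub_ne_zero.2 hy)
  rw [powerInversion, add_sub_cancel_left, norm_smul, Real.norm_eq_abs, abs_div,
    abs_of_nonneg (sq_nonneg ‖y - x‖)]
  field_simp

theorem powerInversion_powerInversion (x : E) {P : ℝ} (hP : P ≠ 0) {y : E} (hy : y ≠ x) :
    powerInversion x P (powerInversion x P y) = y := by
  have h : ‖y - x‖ ≠ 0 := norm_ne_zero_iff.2 (sub_ne_zero.2 hy)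
  have hn := norm_powerInversion_sub x P hy
  rw [powerInversion, hn, powerInversion, add_sub_cancel_left, smul_smul, div_pow, sq_abs]
  have : P / (P ^ 2 / ‖y - x‖ ^ 2) * (P / ‖y - x‖ ^ 2) = 1 := by field_simp
  rw [this, one_smul, add_sub_cancel]

theorem norm_powerInversion {R : ℝ} (x : E) {y : E} (hR : ‖y‖ = R) (hy : y ≠ x) :
    ‖powerInversion x (‖x‖ ^ 2 - R ^ 2) y‖ = R := by
  have h : ‖y - x‖ ^ 2 ≠ 0 := pow_ne_zero 2 (norm_ne_zero_iff.2 (sub_ne_zero.2 hy))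
  have hR0 : 0 ≤ R := hR ▸ norm_nonneg y
  have h2 : ‖y - x‖ ^ 2 = R ^ 2 - 2 * inner ℝ y x + ‖x‖ ^ 2 := by
    rw [norm_sub_sq_real, hR]
  have h3 : inner ℝ x (y - x) = (R ^ 2 - ‖x‖ ^ 2 - ‖y - x‖ ^ 2) / 2 := by
    rw [inner_sub_right, real_inner_self_eq_norm_sq, real_inner_comm, h2]
    ring
  refine (sq_eq_sq₀ (norm_nonneg _) hR0).1 ?_
  rw [powerInversion, norm_add_sq_real, inner_smul_right, norm_smul, mul_pow, Real.norm_eq_abs,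
    sq_abs, h3]
  generalize ‖y - x‖ ^ 2 = d at h
  field_simp
  ring

theorem dist_powerInversion_sq (x : E) (P : ℝ) {y z : E} (hy : y ≠ x) (hz : z ≠ x) :
    dist (powerInversion x P y) (powerInversion x P z) ^ 2 =
      |P| / ‖x - y‖ ^ 2 * (|P| / ‖x - z‖ ^ 2) * dist y z ^ 2 := by
  have h := dist_div_norm_sq_smul (sub_ne_zero.2 hy) (sub_ne_zero.2 hz) 1
  have hsmul : ∀ u : E, (P / ‖u‖ ^ 2) • u = P • ((1 / ‖u‖) ^ 2 • u) := by
    intro u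
    rw [smul_smul]
    congr 1
    ring
  rw [dist_sub_right] at h
  rw [powerInversion, powerInversion, dist_add_left, hsmul, hsmul, dist_smul₀, h,
    Real.norm_eq_abs, norm_sub_rev x y, norm_sub_rev x z]
  ring

end SecondIntersection

/-- Integrals over a sphere of `ω ^ (k / 2)` times an odd function of `log ω` vanish. -/
theorem integral_sRatio_rpow_mul_odd_log_eq_zero {n : ℕ} (k : ℕ) (R : ℝ)
    (x : EuclideanSpace ℝ (Fin n)) (hx : ‖x‖ ≠ R) (hR : 0 < R)
    {g : ℝ → ℝ} (hg : Measurable g) (hodd : ∀ s, g (-s) = -g s) :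
    ∫ y in Metric.sphere (0 : EuclideanSpace ℝ (Fin n)) R,
      (sRatio R x y) ^ ((k : ℝ) / 2) * g (Real.log (sRatio R x y)) ∂μH[(k : ℝ)] = 0 := by
  have hP : ‖x‖ ^ 2 - R ^ 2 ≠ 0 :=
    sub_ne_zero.2 fun h => hx ((sq_eq_sq₀ (norm_nonneg x) hR.le).1 h)
  have hne : ∀ y ∈ Metric.sphere (0 : EuclideanSpace ℝ (Fin n)) R, y ≠ x := by
    rintro y hy rfl
    exact hx (by simpa using hy)
  have hnonneg : ∀ y, 0 ≤ sRatio R x y := fun y => by unfold sRatio; positivity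
  have hmeas : Measurable (sRatio R x) := by unfold sRatio; fun_prop
  have hpos : ∀ y ∈ Metric.sphere (0 : EuclideanSpace ℝ (Fin n)) R, sRatio R x y ≠ 0 :=
    fun y hy => div_ne_zero (abs_ne_zero.2 hP)
      (pow_ne_zero 2 (norm_ne_zero_iff.2 (sub_ne_zero.2 (hne y hy).symm)))
  refine integral_rpow_mul_odd_log_eq_zero (f := powerInversion x (‖x‖ ^ 2 - R ^ 2))
    (w := fun y => ⟨sRatio R x y, hnonneg y⟩) k Metric.isClosed_sphere.measurableSet
    (by unfold powerInversion; fun_prop) (hmeas.subtype_mk) (fun y hy => ?_)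
    (fun y hy => powerInversion_powerInversion x hP (hne y hy))
    (fun y hy h => hpos y hy (congrArg NNReal.toReal h)) (fun y hy => NNReal.eq ?_)
    (fun y hy z hz => dist_powerInversion_sq x _ (hne y hy) (hne z hz)) hg hodd
  · rw [mem_sphere_zero_iff_norm] at hy ⊢
    exact norm_powerInversion x hy (hne y (by simpa using hy))
  · change sRatio R x _ = (sRatio R x y)⁻¹
    have h : ‖y - x‖ ≠ 0 := norm_ne_zero_iff.2 (sub_ne_zero.2 (hne y hy))
    have hP' := abs_ne_zero.2 hP
    rw [sRatio, sRatio, norm_sub_rev x, norm_powerInversion_sub x _ (hne y hy), norm_sub_rev x y]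
    field_simp

theorem stmt_5 (k : ℕ) (hk : 1 ≤ k) (R : ℝ) (hR : 0 < R)
    (x : EuclideanSpace ℝ (Fin (k + 1))) (hx : ‖x‖ ≠ R) (b : ℝ) (m : ℕ) :
    (∫ y in Metric.sphere (0 : EuclideanSpace ℝ (Fin (k + 1))) R,
        (sRatio R x y) ^ ((k : ℝ) / 2) * (Real.log (sRatio R x y)) ^ (2 * m + 1) *
          Real.cos (b * Real.log (sRatio R x y)) ∂(μH[(k : ℝ)]) = 0) ∧
    (∫ y in Metric.sphere (0 : EuclideanSpace ℝ (Fin (k + 1))) R,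
        (sRatio R x y) ^ ((k : ℝ) / 2) * (Real.log (sRatio R x y)) ^ (2 * m) *
          Real.sin (b * Real.log (sRatio R x y)) ∂(μH[(k : ℝ)]) = 0) := by
  constructor
  · simpa only [mul_assoc] using integral_sRatio_rpow_mul_odd_log_eq_zero k R x hx hR
      (g := fun s => s ^ (2 * m + 1) * Real.cos (b * s)) (by fun_prop) fun s => by
        rw [mul_neg, Real.cos_neg, Odd.neg_pow ⟨m, rfl⟩, neg_mul]
  · simpa only [mul_assoc] using integral_sRatio_rpow_mul_odd_log_eq_zero k R x hx hR
      (g := fun s => s ^ (2 * m) * Real.sin (b * s)) (by fun_prop) fun s => by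
        rw [mul_neg, Real.sin_neg, Even.neg_pow (even_two_mul m), mul_neg]
end
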